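/- Let p ≥ 3 be an odd integer and χ_p > 0, and let (a_n)_{n∈ℤ} and (b_n)_{n∈ℤ} be real sequences with Σ_{n∈ℤ} (a_n² + b_n²) < ∞ and Σ_{n∈ℤ} |a_n|^{p+1} < ∞. Then there exists a family u = (u_n)_{n∈ℤ} of C² real functions on [0,∞) solving the on-site lattice equation ü_n(t) = Δu_n(t) − χ_p·u_n(t)^p for all n ∈ ℤ and all t ≥ 0, with u_n(0) = a_n and u̇_n(0) = b_n, such that sup_{0≤t<T} Σ_{n∈ℤ} [ u̇_n(t)² + u_n(t)² ] < ∞ for every T > 0; moreover u is unique among solutions satisfying this bound for every T > 0. -/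

import Mathlib

open Set Filter

/-- Lattice Green function `G₁(n,t) = (2/π) ∫_{-π}^{π} cos(2σn) sin(2t sin σ) sin σ dσ`. -/
noncomputable def G1fun (n : ℤ) (t : ℝ) : ℝ :=
  (2 / Real.pi) * ∫ σ in (-Real.pi)..Real.pi,
    Real.cos (2 * σ * (n : ℝ)) * Real.sin (2 * t * Real.sin σ) * Real.sin σ

/-- Lattice Green function `G(n,t) = (2/π) ∫_{-π}^{π} cos(2σn) sin(2t sin σ)/sin σ dσ`,
with the integrand extended by its limiting value `2t cos(2σn)` where `sin σ = 0`. -/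
noncomputable def Gfun (n : ℤ) (t : ℝ) : ℝ :=
  (2 / Real.pi) * ∫ σ in (-Real.pi)..Real.pi,
    if Real.sin σ = 0 then 2 * t * Real.cos (2 * σ * (n : ℝ))
    else Real.cos (2 * σ * (n : ℝ)) * Real.sin (2 * t * Real.sin σ) / Real.sin σ

/-- Discrete Laplacian `Δf_n = f_{n+1} + f_{n-1} - 2 f_n`. -/
noncomputable def lap (f : ℤ → ℝ) (n : ℤ) : ℝ := f (n + 1) + f (n - 1) - 2 * f n

/-- The tail sum `Σ_{m ≤ n-1} f_m`. -/
noncomputable def tailSum (f : ℤ → ℝ) (n : ℤ) : ℝ := ∑' m : {m : ℤ // m ≤ n - 1}, f m.1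

/-- Convergence of the tail series `Σ_{m ≤ n-1} f_m`. -/
def TailSummable (f : ℤ → ℝ) (n : ℤ) : Prop :=
  Summable (fun m : {m : ℤ // m ≤ n - 1} => f m.1)

/-- The family `α` (with time derivatives taken within `s`) has finite energy norm on `[0,T)`:
`sup_{0≤t<T} [ Σ_n (Σ_{m≤n-1} α̇_m(t))² + Σ_n α_n(t)² ] < ∞`
(in particular all the series involved converge). -/
def FiniteEnergyOn (α : ℤ → ℝ → ℝ) (s : Set ℝ) (T : ℝ) : Prop :=
  (∀ n : ℤ, ∀ t ∈ Ico (0 : ℝ) T, TailSummable (fun m => derivWithin (α m) s t) n) ∧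
  ∃ M : ℝ, ∀ t ∈ Ico (0 : ℝ) T,
    Summable (fun n : ℤ => (tailSum (fun m => derivWithin (α m) s t) n) ^ 2) ∧
    Summable (fun n : ℤ => (α n t) ^ 2) ∧
    (∑' n : ℤ, (tailSum (fun m => derivWithin (α m) s t) n) ^ 2)
      + (∑' n : ℤ, (α n t) ^ 2) ≤ M

/-- `α` solves the FPU lattice equation `α̈_n = Δα_n + χ Δ(α_n^p)` on `s`. -/
def SolvesFPU (p : ℕ) (χ : ℝ) (α : ℤ → ℝ → ℝ) (s : Set ℝ) : Prop :=
  ∀ n : ℤ, ∀ t ∈ s,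
    derivWithin (derivWithin (α n) s) s t
      = lap (fun m => α m t) n + χ * lap (fun m => (α m t) ^ p) n

/-- `α` solves the sine-Gordon lattice equation `α̈_n = Δα_n + χ Δ(sin α_n)` on `s`. -/
def SolvesSG (χ : ℝ) (α : ℤ → ℝ → ℝ) (s : Set ℝ) : Prop :=
  ∀ n : ℤ, ∀ t ∈ s,
    derivWithin (derivWithin (α n) s) s t
      = lap (fun m => α m t) n + χ * lap (fun m => Real.sin (α m t)) n

/-- `u` solves the on-site lattice equation `ü_n = Δu_n - χ u_n^p` on `s`. -/
def SolvesOnSite (p : ℕ) (χ : ℝ) (u : ℤ → ℝ → ℝ) (s : Set ℝ) : Prop :=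
  ∀ n : ℤ, ∀ t ∈ s,
    derivWithin (derivWithin (u n) s) s t = lap (fun m => u m t) n - χ * (u n t) ^ p

/-- On-site energy norm finiteness: `sup_{0≤t<T} Σ_n [u̇_n(t)² + u_n(t)²] < ∞`. -/
def OnSiteFiniteEnergy (u : ℤ → ℝ → ℝ) (s : Set ℝ) (T : ℝ) : Prop :=
  ∃ M : ℝ, ∀ t ∈ Ico (0 : ℝ) T,
    Summable (fun n : ℤ => (derivWithin (u n) s t) ^ 2 + (u n t) ^ 2) ∧
    (∑' n : ℤ, ((derivWithin (u n) s t) ^ 2 + (u n t) ^ 2)) ≤ M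

namespace OnSite

def LocLip {E : Type*} [NormedAddCommGroup E] (f : E → E) : Prop :=
  ∀ ρ : ℝ, ∃ K : ℝ, 0 ≤ K ∧ ∀ x y : E, ‖x‖ ≤ ρ → ‖y‖ ≤ ρ → ‖f x - f y‖ ≤ K * ‖x - y‖

noncomputable def cut {E : Type*} [NormedAddCommGroup E] (R : ℝ) (x : E) : ℝ :=
  max 0 (min 1 (R + 1 - ‖x‖))

section
variable {E : Type*} [NormedAddCommGroup E]

lemma cut_nonneg (R : ℝ) (x : E) : 0 ≤ cut R x := le_max_left _ _

lemma cut_le_one (R : ℝ) (x : E) : cut R x ≤ 1 := max_le zero_le_one (min_le_left _ _)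

lemma cut_eq_one (R : ℝ) (x : E) (h : ‖x‖ ≤ R) : cut R x = 1 := by
  unfold cut
  rw [min_eq_left (by linarith), max_eq_right zero_le_one]

lemma cut_eq_zero (R : ℝ) (x : E) (h : R + 1 ≤ ‖x‖) : cut R x = 0 := by
  unfold cut
  exact max_eq_left ((min_le_right _ _).trans (by linarith))

lemma cut_sub (R : ℝ) (x y : E) : |cut R x - cut R y| ≤ ‖x - y‖ := by
  unfold cut
  have h1 := abs_max_sub_max_le_abs (min 1 (R + 1 - ‖x‖)) (min 1 (R + 1 - ‖y‖)) 0
  have h2 := abs_min_sub_min_le_max 1 (R + 1 - ‖x‖) 1 (R + 1 - ‖y‖)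
  have h3 := abs_norm_sub_norm_le x y
  have h4 : |R + 1 - ‖x‖ - (R + 1 - ‖y‖)| = |‖x‖ - ‖y‖| := by
    rw [← abs_neg]; congr 1; ring
  rw [h4] at h2
  rw [max_comm 0, max_comm 0]
  refine h1.trans (h2.trans ?_)
  simpa using h3

variable [NormedSpace ℝ E]

lemma cutoff_exists [CompleteSpace E] (f : E → E) (hf : LocLip f) (R T : ℝ) (hT : 0 ≤ T) (x₀ : E) :
    ∃ X : ℝ → E, X 0 = x₀ ∧
      ∀ t ∈ Icc 0 T, HasDerivWithinAt X (cut R (X t) • f (X t)) (Icc 0 T) t := by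
  obtain ⟨K₀, hK₀, h₀⟩ := hf (|R| + 1)
  set L : ℝ := ‖f 0‖ + K₀ * (|R| + 1) with hL
  have hLn : 0 ≤ L := by positivity
  have bd : ∀ x, ‖cut R x • f x‖ ≤ L := by
    intro x
    by_cases h : R + 1 ≤ ‖x‖
    · rw [cut_eq_zero R x h]; simpa using hLn
    · push Not at h
      have hx : ‖x‖ ≤ |R| + 1 := by linarith [le_abs_self R]
      have h1 := h₀ x 0 hx (by simpa using by positivity)
      rw [norm_smul, Real.norm_of_nonneg (cut_nonneg R x)]
      calc cut R x * ‖f x‖ ≤ 1 * ‖f x‖ := by gcongr; exact cut_le_one R x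
        _ = ‖f 0 + (f x - f 0)‖ := by simp
        _ ≤ ‖f 0‖ + ‖f x - f 0‖ := norm_add_le _ _
        _ ≤ ‖f 0‖ + K₀ * (|R| + 1) := by
          gcongr
          refine h1.trans ?_
          gcongr
          simpa using hx
  set a : ℝ := L * T with ha
  have han : 0 ≤ a := by positivity
  obtain ⟨K₁, hK₁, h₁⟩ := hf (‖x₀‖ + a)
  set B : ℝ := ‖f 0‖ + K₁ * (‖x₀‖ + a) with hB
  have hBn : 0 ≤ B := by positivity
  have lip : LipschitzOnWith (⟨B + K₁, by positivity⟩ : NNReal) (fun x => cut R x • f x)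
      (Metric.closedBall x₀ a) := by
    apply LipschitzOnWith.of_dist_le_mul
    intro x hx y hy
    have hx' : ‖x‖ ≤ ‖x₀‖ + a := by
      rw [mem_closedBall_iff_norm] at hx
      have := norm_le_norm_add_norm_sub' x x₀
      linarith
    have hy' : ‖y‖ ≤ ‖x₀‖ + a := by
      rw [mem_closedBall_iff_norm] at hy
      have := norm_le_norm_add_norm_sub' y x₀
      linarith
    have hfx : ‖f x‖ ≤ B := by
      have h1 := h₁ x 0 hx' (by simpa using by positivity)
      calc ‖f x‖ = ‖f 0 + (f x - f 0)‖ := by simp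
        _ ≤ ‖f 0‖ + ‖f x - f 0‖ := norm_add_le _ _
        _ ≤ ‖f 0‖ + K₁ * (‖x₀‖ + a) := by
          gcongr
          refine h1.trans ?_
          gcongr
          simpa using hx'
    rw [dist_eq_norm, dist_eq_norm]
    change _ ≤ (B + K₁) * ‖x - y‖
    have e : cut R x • f x - cut R y • f y
        = (cut R x - cut R y) • f x + cut R y • (f x - f y) := by
      rw [sub_smul, smul_sub]; abel
    rw [e]
    refine (norm_add_le _ _).trans ?_
    rw [norm_smul, norm_smul, Real.norm_eq_abs, Real.norm_of_nonneg (cut_nonneg R y)]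
    have := cut_sub R x y
    have h2 := h₁ x y hx' hy'
    calc |cut R x - cut R y| * ‖f x‖ + cut R y * ‖f x - f y‖
        ≤ ‖x - y‖ * B + 1 * (K₁ * ‖x - y‖) := by
          gcongr
          exact cut_le_one R y
      _ = _ := by ring
  have pl : IsPicardLindelof (fun _ : ℝ => fun x => cut R x • f x) (tmin := 0) (tmax := T)
      ⟨0, le_rfl, hT⟩ x₀ ⟨a, han⟩ 0 ⟨L, hLn⟩ ⟨B + K₁, by positivity⟩ := by
    apply IsPicardLindelof.of_time_independent
    · intro x _; exact bd x
    · exact lip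
    · change L * max (T - 0) (0 - 0) ≤ a - 0
      simp [ha, max_eq_left hT]
  obtain ⟨X, h0, hX⟩ := pl.exists_eq_forall_mem_Icc_hasDerivWithinAt₀
  exact ⟨X, h0, hX⟩

lemma global_exists (f : E → E) (hf : LocLip f) (x₀ : E)
    (h : ∀ T : ℝ, 0 ≤ T → ∃ X : ℝ → E, X 0 = x₀ ∧
      ∀ t ∈ Icc 0 T, HasDerivWithinAt X (f (X t)) (Icc 0 T) t) :
    ∃ X : ℝ → E, X 0 = x₀ ∧ ∀ t ∈ Ici (0:ℝ), HasDerivWithinAt X (f (X t)) (Ici 0) t := by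
  choose! X hX0 hX using h
  have key : ∀ S T : ℝ, 0 ≤ S → S ≤ T → EqOn (X S) (X T) (Icc 0 S) := by
    intro S T hS hST
    have c1 : ContinuousOn (X S) (Icc 0 S) := fun t ht => (hX S hS t ht).continuousWithinAt
    have hsub : Icc 0 S ⊆ Icc 0 T := Icc_subset_Icc_right hST
    have c2 : ContinuousOn (X T) (Icc 0 S) := fun t ht =>
      ((hX T (hS.trans hST) t (hsub ht)).mono hsub).continuousWithinAt
    obtain ⟨C1, hC1⟩ := isCompact_Icc.exists_bound_of_continuousOn c1
    obtain ⟨C2, hC2⟩ := isCompact_Icc.exists_bound_of_continuousOn c2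
    obtain ⟨K, hK, hlip⟩ := hf (max C1 C2)
    have lip : LipschitzOnWith (⟨K, hK⟩ : NNReal) f {x | ‖x‖ ≤ max C1 C2} := by
      apply LipschitzOnWith.of_dist_le_mul
      intro x hx y hy
      rw [dist_eq_norm, dist_eq_norm]
      exact hlip x y hx hy
    refine ODE_solution_unique_of_mem_Icc_right (v := fun _ => f)
      (s := fun _ => {x | ‖x‖ ≤ max C1 C2}) (fun _ _ => lip) c1 ?_ ?_ c2 ?_ ?_ ?_
    · intro t ht
      exact (hX S hS t (Ico_subset_Icc_self ht)).mono_of_mem_nhdsWithin (Icc_mem_nhdsGE_of_mem ht)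
    · intro t ht; exact (hC1 t (Ico_subset_Icc_self ht)).trans (le_max_left _ _)
    · intro t ht
      exact ((hX T (hS.trans hST) t (hsub (Ico_subset_Icc_self ht))).mono
        hsub).mono_of_mem_nhdsWithin (Icc_mem_nhdsGE_of_mem ht)
    · intro t ht; exact (hC2 t (Ico_subset_Icc_self ht)).trans (le_max_right _ _)
    · rw [hX0 S hS, hX0 T (hS.trans hST)]
  refine ⟨fun t => X t t, hX0 0 le_rfl, ?_⟩
  intro t ht
  have ht : 0 ≤ t := ht
  have e : ∀ s ∈ Icc 0 (t + 1), X s s = X (t + 1) s := fun s hs =>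
    key s (t + 1) hs.1 hs.2 ⟨hs.1, le_rfl⟩
  have htm : t ∈ Icc 0 (t + 1) := ⟨ht, by linarith⟩
  have h1 := hX (t + 1) (by linarith) t htm
  have h2 : HasDerivWithinAt (fun s => X s s) (f (X (t + 1) t)) (Icc 0 (t + 1)) t :=
    h1.congr e (e t htm)
  rw [← e t htm] at h2
  refine h2.mono_of_mem_nhdsWithin ?_
  rw [← Ici_inter_Iic]
  exact inter_mem self_mem_nhdsWithin (mem_nhdsWithin_of_mem_nhds (Iic_mem_nhds (by linarith)))
end

lemma pow_lip (k : ℕ) (ρ : ℝ) (hρ : 0 ≤ ρ) : ∃ C : ℝ, 0 ≤ C ∧ ∀ x y : ℝ, |x| ≤ ρ → |y| ≤ ρ →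
    |x ^ k - y ^ k| ≤ C * |x - y| := by
  induction k with
  | zero => exact ⟨0, le_rfl, by intros; simp⟩
  | succ k ih =>
    obtain ⟨C, hC, h⟩ := ih
    refine ⟨ρ * C + ρ ^ k, by positivity, fun x y hx hy => ?_⟩
    have e : x ^ (k + 1) - y ^ (k + 1) = x * (x ^ k - y ^ k) + y ^ k * (x - y) := by ring
    rw [e]
    refine (abs_add_le _ _).trans ?_
    rw [abs_mul, abs_mul, abs_pow]
    calc |x| * |x ^ k - y ^ k| + |y| ^ k * |x - y| ≤ ρ * (C * |x - y|) + ρ ^ k * |x - y| := by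
          gcongr; exact h x y hx hy
      _ = _ := by ring

lemma pow_taylor (k : ℕ) (ρ : ℝ) (hρ : 0 ≤ ρ) : ∃ C : ℝ, 0 ≤ C ∧ ∀ x y : ℝ, |x| ≤ ρ → |y| ≤ ρ →
    |y ^ (k + 1) - x ^ (k + 1) - (k + 1) * x ^ k * (y - x)| ≤ C * (y - x) ^ 2 := by
  induction k with
  | zero => exact ⟨0, le_rfl, by intros; simp⟩
  | succ k ih =>
    obtain ⟨C, hC, h⟩ := ih
    refine ⟨ρ * C + (k + 1) * ρ ^ k, by positivity, fun x y hx hy => ?_⟩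
    have e : y ^ (k + 1 + 1) - x ^ (k + 1 + 1) - ((k + 1 : ℕ) + 1) * x ^ (k + 1) * (y - x)
      = y * (y ^ (k + 1) - x ^ (k + 1) - (k + 1) * x ^ k * (y - x))
        + ((k + 1) * x ^ k) * (y - x) ^ 2 := by push_cast; ring
    rw [e]
    refine (abs_add_le _ _).trans ?_
    rw [abs_mul, abs_mul, abs_mul, abs_pow, abs_of_nonneg (sq_nonneg (y - x)),
      abs_of_nonneg (by positivity : (0:ℝ) ≤ k + 1)]
    calc |y| * |y ^ (k + 1) - x ^ (k + 1) - (k + 1) * x ^ k * (y - x)|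
          + ((k + 1) * |x| ^ k) * (y - x) ^ 2
        ≤ ρ * (C * (y - x) ^ 2) + ((k + 1) * ρ ^ k) * (y - x) ^ 2 := by
          gcongr; exact h x y hx hy
      _ = _ := by ring

lemma gron (e e' : ℤ → ℝ → ℝ) (A T S : ℝ) (hA : 0 ≤ A) (hS : 0 ≤ S)
    (he : ∀ n t, 0 ≤ e n t)
    (hsum : ∀ t ∈ Ico 0 T, Summable (fun n => e n t) ∧ ∑' n, e n t ≤ S)
    (h0 : ∀ n, e n 0 = 0)
    (hder : ∀ n, ∀ t, 0 ≤ t → HasDerivWithinAt (e n) (e' n t) (Ici 0) t)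
    (hbd : ∀ t ∈ Ico 0 T, ∀ n, e' n t ≤ A * e n t + e (n + 1) t + e (n - 1) t) :
    ∀ n, ∀ t ∈ Ico 0 T, e n t = 0 := by
  set K := A + 2 with hK
  have claim : ∀ k : ℕ, ∀ t ∈ Ico 0 T, ∑' n, e n t ≤ S / 2 ^ k * Real.exp (2 * K * t) := by
    intro k
    induction k with
    | zero =>
      intro t ht
      refine (hsum t ht).2.trans ?_
      have : 1 ≤ Real.exp (2 * K * t) := Real.one_le_exp (by have := ht.1; positivity)
      simp only [pow_zero, div_one]
      nlinarith
    | succ k ih =>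
      intro t₀ ht₀
      refine (hsum t₀ ht₀).1.tsum_le_of_sum_le fun F => ?_
      have sub : ∀ t ∈ Icc 0 t₀, t ∈ Ico 0 T := fun t ht => ⟨ht.1, ht.2.trans_lt ht₀.2⟩
      have hd : ∀ t, 0 ≤ t → HasDerivWithinAt (fun t => ∑ n ∈ F, e n t) (∑ n ∈ F, e' n t)
          (Ici 0) t := by
        intro t ht
        exact HasDerivWithinAt.fun_sum fun n _ => hder n t ht
      have hB : ∀ t, HasDerivAt (fun t => S / 2 ^ (k + 1) * Real.exp (2 * K * t))
          (K * (S / 2 ^ k * Real.exp (2 * K * t))) t := by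
        intro t
        have h1 : HasDerivAt (fun t => 2 * K * t) (2 * K) t := by
          simpa using (hasDerivAt_id t).const_mul (2 * K)
        have := (h1.exp).const_mul (S / 2 ^ (k + 1))
        refine this.congr_deriv ?_
        rw [pow_succ]
        field_simp
      refine image_le_of_deriv_right_le_deriv_boundary (a := 0) (b := t₀)
        (f := fun t => ∑ n ∈ F, e n t) (f' := fun t => ∑ n ∈ F, e' n t)
        (B := fun t => S / 2 ^ (k + 1) * Real.exp (2 * K * t))
        (B' := fun t => K * (S / 2 ^ k * Real.exp (2 * K * t))) ?_ ?_ ?_ ?_ ?_ ?_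
        (right_mem_Icc.2 ht₀.1)
      · intro t ht
        exact ((hd t ht.1).mono Icc_subset_Ici_self).continuousWithinAt
      · intro t ht
        exact (hd t ht.1).mono (Ici_subset_Ici.2 ht.1)
      · simp only [h0, Finset.sum_const_zero]
        positivity
      · intro t _; exact (hB t).continuousAt.continuousWithinAt
      · intro t _; exact (hB t).hasDerivWithinAt
      · intro t ht
        have htT := sub t (Ico_subset_Icc_self ht)
        have hs := (hsum t htT).1
        have hs1 : Summable (fun n => e (n + 1) t) := (Equiv.addRight (1:ℤ)).summable_iff.2 hs
        have hs2 : Summable (fun n => e (n - 1) t) := (Equiv.subRight (1:ℤ)).summable_iff.2 hs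
        have q1 : ∑' n, e (n + 1) t = ∑' n, e n t := (Equiv.addRight (1:ℤ)).tsum_eq (fun n => e n t)
        have q2 : ∑' n, e (n - 1) t = ∑' n, e n t := (Equiv.subRight (1:ℤ)).tsum_eq (fun n => e n t)
        calc ∑ n ∈ F, e' n t ≤ ∑ n ∈ F, (A * e n t + e (n + 1) t + e (n - 1) t) :=
              Finset.sum_le_sum fun n _ => hbd t htT n
          _ = A * ∑ n ∈ F, e n t + ∑ n ∈ F, e (n + 1) t + ∑ n ∈ F, e (n - 1) t := by
              rw [Finset.sum_add_distrib, Finset.sum_add_distrib, Finset.mul_sum]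
          _ ≤ A * ∑' n, e n t + ∑' n, e (n + 1) t + ∑' n, e (n - 1) t := by
              gcongr
              · exact hs.sum_le_tsum F fun n _ => he n t
              · exact hs1.sum_le_tsum F fun n _ => he _ t
              · exact hs2.sum_le_tsum F fun n _ => he _ t
          _ = K * ∑' n, e n t := by rw [q1, q2]; ring
          _ ≤ _ := by gcongr; exact ih t htT
  intro n t ht
  apply le_antisymm _ (he n t)
  have h1 : ∀ k : ℕ, e n t ≤ S / 2 ^ k * Real.exp (2 * K * t) := fun k =>
    ((hsum t ht).1.le_tsum n fun m _ => he m t).trans (claim k t ht)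
  have h2 : Tendsto (fun k : ℕ => S / 2 ^ k * Real.exp (2 * K * t)) atTop (nhds 0) := by
    have := ((tendsto_pow_atTop_nhds_zero_of_lt_one (r := (1/2:ℝ)) (by norm_num)
      (by norm_num)).const_mul S).mul_const (Real.exp (2 * K * t))
    simp only [mul_zero, zero_mul] at this
    refine this.congr fun k => ?_
    rw [one_div, inv_pow, div_eq_mul_inv]
  exact ge_of_tendsto' h2 h1

lemma uniq (p : ℕ) (χ : ℝ) (hχ : 0 < χ) (u v u' v' : ℤ → ℝ → ℝ)
    (hu : ∀ n, ∀ t, 0 ≤ t → HasDerivWithinAt (u n) (v n t) (Ici 0) t)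
    (hv : ∀ n, ∀ t, 0 ≤ t →
      HasDerivWithinAt (v n) (lap (fun m => u m t) n - χ * (u n t) ^ p) (Ici 0) t)
    (hu' : ∀ n, ∀ t, 0 ≤ t → HasDerivWithinAt (u' n) (v' n t) (Ici 0) t)
    (hv' : ∀ n, ∀ t, 0 ≤ t →
      HasDerivWithinAt (v' n) (lap (fun m => u' m t) n - χ * (u' n t) ^ p) (Ici 0) t)
    (h0 : ∀ n, u n 0 = u' n 0) (h1 : ∀ n, v n 0 = v' n 0)
    (T M M' : ℝ)
    (hM : ∀ t ∈ Ico 0 T, Summable (fun n => v n t ^ 2 + u n t ^ 2) ∧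
      ∑' n, (v n t ^ 2 + u n t ^ 2) ≤ M)
    (hM' : ∀ t ∈ Ico 0 T, Summable (fun n => v' n t ^ 2 + u' n t ^ 2) ∧
      ∑' n, (v' n t ^ 2 + u' n t ^ 2) ≤ M') :
    ∀ n, ∀ t ∈ Ico 0 T, u n t = u' n t := by
  intro n t ht
  have hMn : 0 ≤ M := (tsum_nonneg fun n => by positivity).trans (hM t ht).2
  have hMn' : 0 ≤ M' := (tsum_nonneg fun n => by positivity).trans (hM' t ht).2
  obtain ⟨C, hC, hlip⟩ := pow_lip p (M + M' + 1) (by positivity)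
  have key := gron (fun n t => (u n t - u' n t) ^ 2 + (v n t - v' n t) ^ 2)
    (fun n t => 2 * (u n t - u' n t) * (v n t - v' n t) + 2 * (v n t - v' n t) *
      ((lap (fun m => u m t) n - χ * (u n t) ^ p) - (lap (fun m => u' m t) n - χ * (u' n t) ^ p)))
    (5 + χ * C) T (2 * M + 2 * M') (by positivity) (by positivity) (fun n t => by positivity)
    ?_ ?_ ?_ ?_ n t ht
  · have : (u n t - u' n t) ^ 2 = 0 := by
      have a1 := sq_nonneg (u n t - u' n t)
      have a2 := sq_nonneg (v n t - v' n t)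
      linarith
    have := pow_eq_zero_iff (two_ne_zero) |>.1 this
    linarith
  · intro t ht
    obtain ⟨s1, b1⟩ := hM t ht
    obtain ⟨s2, b2⟩ := hM' t ht
    have s3 := (s1.mul_left 2).add (s2.mul_left 2)
    have le : ∀ n, (u n t - u' n t) ^ 2 + (v n t - v' n t) ^ 2 ≤
        2 * (v n t ^ 2 + u n t ^ 2) + 2 * (v' n t ^ 2 + u' n t ^ 2) := by
      intro n
      nlinarith [sq_nonneg (u n t + u' n t), sq_nonneg (v n t + v' n t)]
    have s4 := Summable.of_nonneg_of_le (fun n => by positivity) le s3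
    refine ⟨s4, (s4.tsum_le_tsum le s3).trans ?_⟩
    rw [(s1.mul_left 2).tsum_add (s2.mul_left 2), tsum_mul_left, tsum_mul_left]
    linarith
  · intro n; simp [h0, h1]
  · intro n t ht
    have d1 := ((hu n t ht).sub (hu' n t ht)).pow 2
    have d2 := ((hv n t ht).sub (hv' n t ht)).pow 2
    refine (d1.add d2).congr_deriv ?_
    simp
  · intro t ht n
    have b : ∀ n, |u n t| ≤ M + M' + 1 := by
      intro n
      have := ((hM t ht).1.le_tsum n fun m _ => by positivity).trans (hM t ht).2
      apply abs_le_of_sq_le_sq _ (by positivity)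
      nlinarith [sq_nonneg (v n t)]
    have b' : ∀ n, |u' n t| ≤ M + M' + 1 := by
      intro n
      have := ((hM' t ht).1.le_tsum n fun m _ => by positivity).trans (hM' t ht).2
      apply abs_le_of_sq_le_sq _ (by positivity)
      nlinarith [sq_nonneg (v' n t)]
    have l := hlip _ _ (b n) (b' n)
    simp only [lap]
    set w := u n t - u' n t with hw
    set z := v n t - v' n t with hz
    set wp := u (n + 1) t - u' (n + 1) t with hwp
    set wm := u (n - 1) t - u' (n - 1) t with hwm
    set g := u n t ^ p - u' n t ^ p with hg
    have e1 : (u (n + 1) t + u (n - 1) t - 2 * u n t - χ * u n t ^ p -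
        (u' (n + 1) t + u' (n - 1) t - 2 * u' n t - χ * u' n t ^ p))
        = wp + wm - 2 * w - χ * g := by rw [hw, hwp, hwm, hg]; ring
    rw [e1]
    have e2 : -(2 * (z * g)) ≤ C * (z ^ 2 + w ^ 2) := by
      have : |z * g| ≤ |z| * (C * |w|) := by rw [abs_mul]; gcongr
      have h3 := neg_abs_le (z * g)
      have h4 : 2 * (|z| * |w|) ≤ z ^ 2 + w ^ 2 := by
        nlinarith [sq_nonneg (|z| - |w|), sq_abs z, sq_abs w]
      nlinarith [mul_le_mul_of_nonneg_left h4 hC]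
    have e3 := mul_le_mul_of_nonneg_left e2 hχ.le
    nlinarith [sq_nonneg (z - wp), sq_nonneg (z - wm), sq_nonneg (z + w), sq_nonneg (z - w),
      sq_nonneg (v (n + 1) t - v' (n + 1) t), sq_nonneg (v (n - 1) t - v' (n - 1) t),
      sq_nonneg w, sq_nonneg z]

abbrev H : Type := lp (fun _ : ℤ => ℝ) 2

lemma H_norm_sq (x : H) : HasSum (fun n => (x n) ^ 2) (‖x‖ ^ 2) := by
  have := lp.hasSum_norm (p := 2) (by norm_num) x
  simpa using this

lemma H_apply_le (x : H) (n : ℤ) : |x n| ≤ ‖x‖ := lp.norm_apply_le_norm (by norm_num) x n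

lemma H_mem (f : ℤ → ℝ) (h : Summable fun n => (f n) ^ 2) : Memℓp f 2 := by
  apply memℓp_gen
  simpa using h

lemma H_norm_le (x y : H) (C : ℝ) (hC : 0 ≤ C) (h : ∀ n, |x n| ≤ C * |y n|) :
    ‖x‖ ≤ C * ‖y‖ := by
  have h1 : ‖x‖ ≤ ‖C • y‖ := by
    apply lp.norm_mono (by norm_num)
    intro n
    simpa [abs_of_nonneg hC] using h n
  rwa [norm_smul, Real.norm_of_nonneg hC] at h1

/-- shift operator -/
noncomputable def shift (k : ℤ) : H →L[ℝ] H :=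
  LinearMap.mkContinuous
    { toFun := fun x => ⟨fun n => x (n + k), H_mem _
        ((Equiv.addRight k).summable_iff.2 (H_norm_sq x).summable)⟩
      map_add' := fun x y => by ext n; rfl
      map_smul' := fun c x => by ext n; rfl } 1 (by
    intro x
    rw [one_mul]
    refine (abs_le_of_sq_le_sq' ?_ (norm_nonneg _)).2
    rw [← (H_norm_sq x).tsum_eq, ← (H_norm_sq _).tsum_eq]
    exact ((Equiv.addRight k).tsum_eq (fun n => (x n) ^ 2)).le)

lemma shift_apply (k : ℤ) (x : H) (n : ℤ) : shift k x n = x (n + k) := rfl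

lemma shift_norm (k : ℤ) (x : H) : ‖shift k x‖ ≤ ‖x‖ := by
  have := (shift k).le_of_opNorm_le (LinearMap.mkContinuous_norm_le _ zero_le_one _) x
  simpa using this

lemma shift_inner (k : ℤ) (x y : H) : inner ℝ (shift k x) y = inner ℝ x (shift (-k) y) := by
  rw [lp.inner_eq_tsum, lp.inner_eq_tsum,
    ← (Equiv.addRight k).tsum_eq (fun n => inner ℝ (x n) (shift (-k) y n))]
  congr 1
  ext n
  simp [shift_apply]

noncomputable def A : H →L[ℝ] H := shift 1 + shift (-1) - (2:ℝ) • ContinuousLinearMap.id ℝ H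

lemma A_apply (x : H) (n : ℤ) : A x n = lap x n := by
  change x (n + 1) + x (n + -1) - 2 * x n = _
  rfl

lemma A_eq (x : H) : A x = shift 1 x + shift (-1) x - (2:ℝ) • x := rfl

lemma A_symm (x y : H) : inner ℝ (A x) y = inner ℝ x (A y) := by
  rw [A_eq, A_eq]
  simp only [inner_sub_left, inner_sub_right, inner_add_left, inner_add_right, inner_smul_left,
    inner_smul_right, shift_inner, neg_neg]
  simp
  ring

lemma A_nonpos (x : H) : inner ℝ (A x) x ≤ 0 := by
  have h : ∀ k, inner ℝ (shift k x) x ≤ ‖x‖ ^ 2 := fun k => by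
    refine (real_inner_le_norm _ _).trans ?_
    rw [sq]
    gcongr
    exact shift_norm k x
  rw [A_eq]
  simp only [inner_sub_left, inner_add_left, inner_smul_left, real_inner_self_eq_norm_sq]
  have h1 := h 1
  have h2 := h (-1)
  simp
  linarith

noncomputable def Nl (p : ℕ) (hp : 1 ≤ p) (x : H) : H :=
  ⟨fun n => (x n) ^ p, H_mem _ (by
    refine Summable.of_nonneg_of_le (fun n => by positivity) (fun n => ?_)
      ((H_norm_sq x).summable.mul_left ((‖x‖ ^ (p - 1)) ^ 2))
    obtain ⟨q, rfl⟩ : ∃ q, p = q + 1 := ⟨p - 1, by omega⟩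
    have h : |x n ^ (q + 1)| ≤ |‖x‖ ^ q * x n| := by
      rw [abs_mul, abs_pow, abs_pow, abs_norm, pow_succ]
      gcongr
      exact H_apply_le x n
    exact (sq_le_sq.2 h).trans_eq (mul_pow _ _ _))⟩

lemma Nl_apply (p : ℕ) (hp : 1 ≤ p) (x : H) (n : ℤ) : Nl p hp x n = (x n) ^ p := rfl

lemma Nl_lip (p : ℕ) (hp : 1 ≤ p) (ρ : ℝ) : ∃ K : ℝ, 0 ≤ K ∧ ∀ x y : H, ‖x‖ ≤ ρ → ‖y‖ ≤ ρ →
    ‖Nl p hp x - Nl p hp y‖ ≤ K * ‖x - y‖ := by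
  obtain ⟨C, hC, h⟩ := pow_lip p |ρ| (abs_nonneg _)
  refine ⟨C, hC, fun x y hx hy => H_norm_le _ _ C hC fun n => ?_⟩
  exact h _ _ ((H_apply_le x n).trans (hx.trans (le_abs_self _)))
    ((H_apply_le y n).trans (hy.trans (le_abs_self _)))

noncomputable def P (p : ℕ) (hp : 1 ≤ p) (x : H) : ℝ := inner ℝ x (Nl p hp x)

lemma P_hasSum (p : ℕ) (hp : 1 ≤ p) (x : H) : HasSum (fun n => (x n) ^ (p + 1)) (P p hp x) := by
  have := lp.hasSum_inner (𝕜 := ℝ) x (Nl p hp x)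
  have e : (fun n => inner ℝ (x n) (Nl p hp x n)) = fun n => (x n) ^ (p + 1) := by
    ext n
    simp [Nl_apply, pow_succ]
  rw [e] at this
  exact this

lemma P_taylor (p : ℕ) (hp : 1 ≤ p) (ρ : ℝ) : ∃ C : ℝ, 0 ≤ C ∧ ∀ x y : H, ‖x‖ ≤ ρ → ‖y‖ ≤ ρ →
    |P p hp y - P p hp x - (p + 1) * inner ℝ (Nl p hp x) (y - x)| ≤ C * ‖y - x‖ ^ 2 := by
  obtain ⟨C, hC, h⟩ := pow_taylor p |ρ| (abs_nonneg _)
  refine ⟨C, hC, fun x y hx hy => ?_⟩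
  have s1 := ((P_hasSum p hp y).sub (P_hasSum p hp x)).sub
    ((lp.hasSum_inner (Nl p hp x) (y - x)).mul_left (p + 1 : ℝ))
  have s2 := (H_norm_sq (y - x)).mul_left C
  rw [← Real.norm_eq_abs]
  refine s1.norm_le_of_bounded s2 fun n => ?_
  have := h (x n) (y n) ((H_apply_le x n).trans (hx.trans (le_abs_self _)))
    ((H_apply_le y n).trans (hy.trans (le_abs_self _)))
  rw [Real.norm_eq_abs]
  refine le_trans (le_of_eq ?_) this
  congr 2
  simp [Nl_apply]
  ring

lemma P_hasFDerivAt (p : ℕ) (hp : 1 ≤ p) (x : H) :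
    HasFDerivAt (P p hp) ((p + 1 : ℝ) • innerSL ℝ (Nl p hp x)) x := by
  obtain ⟨C, hC, h⟩ := P_taylor p hp (‖x‖ + 1)
  rw [hasFDerivAt_iff_isLittleO]
  have h1 : (fun y => P p hp y - P p hp x - ((p + 1 : ℝ) • innerSL ℝ (Nl p hp x)) (y - x))
      =O[nhds x] fun y => ‖y - x‖ ^ 2 := by
    apply Asymptotics.IsBigO.of_bound C
    filter_upwards [Metric.closedBall_mem_nhds x one_pos] with y hy
    rw [mem_closedBall_iff_norm] at hy
    have hy' : ‖y‖ ≤ ‖x‖ + 1 := by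
      have := norm_le_norm_add_norm_sub' y x
      linarith
    have := h x y (by linarith) hy'
    simpa using this
  refine h1.trans_isLittleO ?_
  have h2 : (fun y : H => y - x) =o[nhds x] (fun _ => (1:ℝ)) := by
    rw [Asymptotics.isLittleO_one_iff]
    exact tendsto_sub_nhds_zero_iff.2 tendsto_id
  have h3 := (h2.norm_left).mul_isBigO (Asymptotics.isBigO_refl (fun y => ‖y - x‖) (nhds x))
  simp only [one_mul] at h3
  have h4 := h3.norm_right
  simp only [norm_norm] at h4
  simpa [sq] using h4.of_norm_right

noncomputable def F (p : ℕ) (hp : 1 ≤ p) (χ : ℝ) (x : H × H) : H × H :=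
  (x.2, A x.1 - χ • Nl p hp x.1)

lemma F_lip (p : ℕ) (hp : 1 ≤ p) (χ : ℝ) : LocLip (F p hp χ) := by
  intro ρ
  obtain ⟨K, hK, h⟩ := Nl_lip p hp ρ
  refine ⟨1 + ‖A‖ + |χ| * K, by positivity, fun x y hx hy => ?_⟩
  have h1 : ‖x.1 - y.1‖ ≤ ‖x - y‖ := norm_fst_le (x - y)
  have h2 : ‖x.2 - y.2‖ ≤ ‖x - y‖ := norm_snd_le (x - y)
  have h3 := h x.1 y.1 ((norm_fst_le x).trans hx) ((norm_fst_le y).trans hy)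
  have nn := norm_nonneg (x - y)
  rw [Prod.norm_def]
  apply max_le
  · change ‖x.2 - y.2‖ ≤ _
    refine h2.trans ?_
    have : 0 ≤ (‖A‖ + |χ| * K) * ‖x - y‖ := by positivity
    linarith
  · change ‖(A x.1 - χ • Nl p hp x.1) - (A y.1 - χ • Nl p hp y.1)‖ ≤ _
    have e : (A x.1 - χ • Nl p hp x.1) - (A y.1 - χ • Nl p hp y.1)
        = A (x.1 - y.1) - χ • (Nl p hp x.1 - Nl p hp y.1) := by
      rw [map_sub, smul_sub]; abel
    rw [e]
    refine (norm_sub_le _ _).trans ?_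
    rw [norm_smul, Real.norm_eq_abs]
    calc ‖A (x.1 - y.1)‖ + |χ| * ‖Nl p hp x.1 - Nl p hp y.1‖
        ≤ ‖A‖ * ‖x - y‖ + |χ| * (K * ‖x - y‖) := by
          gcongr
          · exact (A.le_opNorm _).trans (by gcongr)
          · exact h3.trans (by gcongr)
      _ ≤ _ := by nlinarith

noncomputable def En (p : ℕ) (hp : 1 ≤ p) (χ : ℝ) (u v : H) : ℝ :=
  ‖v‖ ^ 2 - inner ℝ (A u) u + 2 * χ / (p + 1) * P p hp u

lemma En_ge (p : ℕ) (hp : 1 ≤ p) (hodd : Odd p) (χ : ℝ) (hχ : 0 < χ) (u v : H) :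
    ‖v‖ ^ 2 ≤ En p hp χ u v := by
  have h1 := A_nonpos u
  have h2 : 0 ≤ P p hp u := (P_hasSum p hp u).nonneg fun n => (hodd.add_one).pow_nonneg _
  have h3 : 0 ≤ 2 * χ / (p + 1) * P p hp u := by positivity
  unfold En
  linarith

lemma En_deriv (p : ℕ) (hp : 1 ≤ p) (χ : ℝ) (u v : ℝ → H) (s : Set ℝ) (t c : ℝ)
    (hu : HasDerivWithinAt u (c • v t) s t)
    (hv : HasDerivWithinAt v (c • (A (u t) - χ • Nl p hp (u t))) s t) :
    HasDerivWithinAt (fun t => En p hp χ (u t) (v t)) 0 s t := by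
  have d1 := hv.norm_sq
  have d2 : HasDerivWithinAt (fun t => A (u t)) (A (c • v t)) s t :=
    A.hasFDerivAt.comp_hasDerivWithinAt t hu
  have d3 := d2.inner ℝ hu
  have d4 : HasDerivWithinAt (fun t => P p hp (u t))
      (((p + 1 : ℝ) • innerSL ℝ (Nl p hp (u t))) (c • v t)) s t :=
    (P_hasFDerivAt p hp (u t)).comp_hasDerivWithinAt t hu
  refine ((d1.sub d3).add (d4.const_mul (2 * χ / (p + 1)))).congr_deriv ?_
  have hp1 : (p + 1 : ℝ) ≠ 0 := by positivity
  simp only [map_smul, inner_smul_left, inner_smul_right, inner_sub_right, A_symm, 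
    smul_apply, innerSL_apply_apply, smul_eq_mul, RCLike.conj_to_real]
  rw [real_inner_comm (A (u t)) (v t), A_symm, real_inner_comm (Nl p hp (u t)) (v t)]
  field_simp
  ring

lemma local_exists (p : ℕ) (hp : 1 ≤ p) (hodd : Odd p) (χ : ℝ) (hχ : 0 < χ) (x₀ : H × H)
    (T : ℝ) (hT : 0 ≤ T) : ∃ X : ℝ → H × H, X 0 = x₀ ∧
      ∀ t ∈ Icc 0 T, HasDerivWithinAt X (F p hp χ (X t)) (Icc 0 T) t := by
  set E₀ := En p hp χ x₀.1 x₀.2 with hE₀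
  set R : ℝ := ‖x₀.1‖ + √E₀ * (T + 1) with hR
  obtain ⟨X, h0, hX⟩ := cutoff_exists (F p hp χ) (F_lip p hp χ) R T hT x₀
  refine ⟨X, h0, ?_⟩
  have du : ∀ t ∈ Icc 0 T, HasDerivWithinAt (fun t => (X t).1) (cut R (X t) • (X t).2)
      (Icc 0 T) t := fun t ht => 
    (ContinuousLinearMap.fst ℝ H H).hasFDerivAt.comp_hasDerivWithinAt t (hX t ht)
  have dv : ∀ t ∈ Icc 0 T, HasDerivWithinAt (fun t => (X t).2)
      (cut R (X t) • (A (X t).1 - χ • Nl p hp (X t).1)) (Icc 0 T) t := fun t ht => 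
    (ContinuousLinearMap.snd ℝ H H).hasFDerivAt.comp_hasDerivWithinAt t (hX t ht)
  have dE : ∀ t ∈ Icc 0 T, HasDerivWithinAt (fun t => En p hp χ (X t).1 (X t).2) 0
      (Icc 0 T) t := fun t ht => En_deriv p hp χ _ _ _ t _ (du t ht) (dv t ht)
  have cE : ∀ t ∈ Icc 0 T, En p hp χ (X t).1 (X t).2 = E₀ := by
    intro t ht
    have := constant_of_has_deriv_right_zero (f := fun t => En p hp χ (X t).1 (X t).2)
      (fun t ht => (dE t ht).continuousWithinAt)
      (fun t ht => (dE t (Ico_subset_Icc_self ht)).mono_of_mem_nhdsWithin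
        (Icc_mem_nhdsGE_of_mem ht)) t ht
    simp only [h0] at this
    exact this
  have bv : ∀ t ∈ Icc 0 T, ‖(X t).2‖ ≤ √E₀ := by
    intro t ht
    apply Real.le_sqrt_of_sq_le
    rw [← cE t ht]
    exact En_ge p hp hodd χ hχ _ _
  have bu : ∀ t ∈ Icc 0 T, ‖(X t).1 - x₀.1‖ ≤ √E₀ * T := by
    intro t ht
    have := norm_image_sub_le_of_norm_deriv_le_segment' du (C := √E₀) (by
      intro t ht
      rw [norm_smul, Real.norm_of_nonneg (cut_nonneg _ _)]
      have h1 := bv t (Ico_subset_Icc_self ht)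
      have h2 := cut_le_one R (X t)
      calc cut R (X t) * ‖(X t).2‖ ≤ 1 * √E₀ := by gcongr
        _ = _ := one_mul _) t ht
    simp only [h0, sub_zero] at this
    refine this.trans ?_
    gcongr
    exact ht.2
  intro t ht
  have hc : cut R (X t) = 1 := by
    apply cut_eq_one
    have h1 := bu t ht
    have h2 := bv t ht
    have h3 := norm_le_norm_add_norm_sub' (X t).1 x₀.1
    have h4 : 0 ≤ √E₀ := Real.sqrt_nonneg _
    have h5 : 0 ≤ √E₀ * T := by positivity
    rw [Prod.norm_def, hR]
    apply max_le
    · linarith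
    · have := norm_nonneg x₀.1
      linarith
  have := hX t ht
  rwa [hc, one_smul] at this

end OnSite

open OnSite in
/-- global existence and uniqueness for the on-site lattice
`ü_n = Δu_n - χ_p u_n^p`, odd `p ≥ 3`, `χ_p > 0`, with square-summable initial data
satisfying additionally `Σ_n |a_n|^{p+1} < ∞`. -/
theorem onsite_global_existence_uniqueness (p : ℕ) (hodd : Odd p) (hp : 3 ≤ p)
    (χ : ℝ) (hχ : 0 < χ) (a b : ℤ → ℝ)
    (hab : Summable fun n : ℤ => (a n) ^ 2 + (b n) ^ 2)
    (hap : Summable fun n : ℤ => |a n| ^ (p + 1)) :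
    ∃ u : ℤ → ℝ → ℝ,
      ((∀ n : ℤ, ContDiffOn ℝ 2 (u n) (Ici 0)) ∧
        SolvesOnSite p χ u (Ici 0) ∧
        (∀ n : ℤ, u n 0 = a n) ∧
        (∀ n : ℤ, derivWithin (u n) (Ici 0) 0 = b n) ∧
        (∀ T : ℝ, 0 < T → OnSiteFiniteEnergy u (Ici 0) T)) ∧
      ∀ u' : ℤ → ℝ → ℝ,
        ((∀ n : ℤ, ContDiffOn ℝ 2 (u' n) (Ici 0)) ∧
          SolvesOnSite p χ u' (Ici 0) ∧
          (∀ n : ℤ, u' n 0 = a n) ∧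
          (∀ n : ℤ, derivWithin (u' n) (Ici 0) 0 = b n) ∧
          (∀ T : ℝ, 0 < T → OnSiteFiniteEnergy u' (Ici 0) T)) →
        ∀ n : ℤ, ∀ t ∈ Ici (0 : ℝ), u' n t = u n t := by
  have hp1 : 1 ≤ p := by omega
  have ha : Summable fun n => (a n) ^ 2 :=
    Summable.of_nonneg_of_le (fun n => by positivity)
      (fun n => by nlinarith [sq_nonneg (b n)]) hab
  have hb : Summable fun n => (b n) ^ 2 :=
    Summable.of_nonneg_of_le (fun n => by positivity)
      (fun n => by nlinarith [sq_nonneg (a n)]) hab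
  obtain ⟨X, h0, hX⟩ := global_exists (F p hp1 χ) (F_lip p hp1 χ)
    ((⟨a, H_mem a ha⟩ : H), (⟨b, H_mem b hb⟩ : H))
    (fun T hT => local_exists p hp1 hodd χ hχ _ T hT)
  have ev : ∀ n : ℤ, ∃ φ : H →L[ℝ] ℝ, ∀ x : H, φ x = x n := fun n =>
    ⟨LinearMap.mkContinuous
      { toFun := fun x : H => x n, map_add' := fun _ _ => rfl, map_smul' := fun _ _ => rfl } 1
      (fun x => by rw [one_mul]; exact H_apply_le x n), fun x => rfl⟩
  set u : ℤ → ℝ → ℝ := fun n t => (X t).1 n with hu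
  set v : ℤ → ℝ → ℝ := fun n t => (X t).2 n with hv
  have du : ∀ n, ∀ t, 0 ≤ t → HasDerivWithinAt (u n) (v n t) (Ici 0) t := by
    intro n t ht
    obtain ⟨φ, hφ⟩ := ev n
    have := (φ.comp (ContinuousLinearMap.fst ℝ H H)).hasFDerivAt.comp_hasDerivWithinAt t (hX t ht)
    have e : (φ.comp (ContinuousLinearMap.fst ℝ H H)) ∘ X = u n := by
      ext s; exact hφ _
    rw [e] at this
    exact this.congr_deriv (hφ _)
  have dv : ∀ n, ∀ t, 0 ≤ t →
      HasDerivWithinAt (v n) (lap (fun m => u m t) n - χ * (u n t) ^ p) (Ici 0) t := by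
    intro n t ht
    obtain ⟨φ, hφ⟩ := ev n
    have := (φ.comp (ContinuousLinearMap.snd ℝ H H)).hasFDerivAt.comp_hasDerivWithinAt t (hX t ht)
    have e : (φ.comp (ContinuousLinearMap.snd ℝ H H)) ∘ X = v n := by
      ext s; exact hφ _
    rw [e] at this
    exact this.congr_deriv (hφ _)
  have ud : UniqueDiffOn ℝ (Ici (0:ℝ)) := uniqueDiffOn_Ici 0
  have dwu : ∀ n, ∀ t ∈ Ici (0:ℝ), derivWithin (u n) (Ici 0) t = v n t := fun n t ht =>
    (du n t ht).derivWithin (ud t ht)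
  have dwv : ∀ n, ∀ t ∈ Ici (0:ℝ), derivWithin (v n) (Ici 0) t
      = lap (fun m => u m t) n - χ * (u n t) ^ p := fun n t ht =>
    (dv n t ht).derivWithin (ud t ht)
  have cu : ∀ n, ContinuousOn (u n) (Ici 0) := fun n t ht => (du n t ht).continuousWithinAt
  have en : ∀ T : ℝ, ∃ M : ℝ, ∀ t ∈ Ico (0:ℝ) T, Summable (fun n => v n t ^ 2 + u n t ^ 2) ∧
      ∑' n, (v n t ^ 2 + u n t ^ 2) ≤ M := by
    intro T
    have cX : ContinuousOn X (Icc 0 T) := fun t ht =>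
      ((hX t ht.1).mono Icc_subset_Ici_self).continuousWithinAt
    obtain ⟨C, hC⟩ := isCompact_Icc.exists_bound_of_continuousOn cX
    refine ⟨C ^ 2 + C ^ 2, fun t ht => ?_⟩
    have hs := (H_norm_sq (X t).2).add (H_norm_sq (X t).1)
    refine ⟨hs.summable, hs.tsum_eq.le.trans ?_⟩
    have := hC t (Ico_subset_Icc_self ht)
    have h1 := (norm_fst_le (X t)).trans this
    have h2 := (norm_snd_le (X t)).trans this
    gcongr
  refine ⟨u, ⟨?_, ?_, ?_, ?_, ?_⟩, ?_⟩
  · intro n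
    have c1 : ContDiffOn ℝ 1 (v n) (Ici 0) := by
      rw [contDiffOn_one_iff_derivWithin ud]
      refine ⟨fun t ht => (dv n t ht).differentiableWithinAt, ?_⟩
      refine ContinuousOn.congr ?_ (dwv n)
      have h1 := cu (n + 1)
      have h2 := cu (n - 1)
      have h3 := cu n
      unfold lap
      fun_prop
    rw [show (2 : WithTop ℕ∞) = 1 + 1 by norm_num, contDiffOn_succ_iff_derivWithin ud]
    refine ⟨fun t ht => (du n t ht).differentiableWithinAt, by simp, c1.congr (dwu n)⟩
  · intro n t ht
    rw [derivWithin_congr (dwu n) (dwu n t ht), dwv n t ht]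
  · intro n; simp only [hu, h0]
  · intro n; rw [dwu n 0 self_mem_Ici]; simp only [hv, h0]
  · intro T _
    obtain ⟨M, hM⟩ := en T
    refine ⟨M, fun t ht => ?_⟩
    have e : (fun n => derivWithin (u n) (Ici 0) t ^ 2 + u n t ^ 2)
      = fun n => v n t ^ 2 + u n t ^ 2 := by
      ext n; rw [dwu n t ht.1]
    rw [e]
    exact hM t ht
  · rintro u' ⟨hc, hs, ha', hb', he⟩ n t ht
    obtain ⟨M, hM⟩ := en (t + 1)
    have ht : 0 ≤ t := ht
    obtain ⟨M', hM'⟩ := he (t + 1) (by linarith)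
    refine (uniq p χ hχ u v u' (fun n => derivWithin (u' n) (Ici 0)) du dv ?_ ?_ ?_ ?_ (t + 1) M M'
      hM hM' n t ⟨ht, by linarith⟩).symm
    · intro n t ht
      exact (((hc n).differentiableOn (by norm_num)) t ht).hasDerivWithinAt
    · intro n t ht
      have h1 : ContDiffOn ℝ 1 (derivWithin (u' n) (Ici 0)) (Ici 0) :=
        (hc n).derivWithin ud (by norm_num)
      have h2 := ((h1.differentiableOn (by norm_num)) t ht).hasDerivWithinAt
      rwa [hs n t ht] at h2
    · intro n; rw [ha' n]; simp only [hu, h0]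
    · intro n; rw [hb' n]; simp only [hv, h0]
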